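/- The flow generated by any continuous interval map f: I → I with zero topological entropy is minimally mean-attractable and minimally mean-L-stable: every point x ∈ I is mean-attracted to some minimal set K of f, and the restriction of f to every minimal set is mean-L-stable. -/

import Mathlib

open Filter Dynamics

open Classical in
/-- The upper density of a set `E ⊆ ℕ`: `limsup_{N→∞} #(E ∩ [1,N]) / N`. -/
noncomputable def upperDensity (E : Set ℕ) : ℝ :=
  limsup (fun N : ℕ => (∑ n ∈ Finset.Icc 1 N, if n ∈ E then (1 : ℝ) else 0) / N) atTop

/-- `K` is a minimal set for `f` on the interval `[a,b]`: nonempty, closed, invariant,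
and every forward orbit in `K` is dense in `K`. -/
def IsMinimalSet (a b : ℝ) (f : ℝ → ℝ) (K : Set ℝ) : Prop :=
  K ⊆ Set.Icc a b ∧ K.Nonempty ∧ IsClosed K ∧ Set.MapsTo f K K ∧
    ∀ x ∈ K, K ⊆ closure (Set.range fun n : ℕ => f^[n] x)

/-- No iterate of `f` is turbulent: whenever `f^[n]` maps `b` to its fixed point `p`, it maps no
point strictly between `b` and `p` to `b` or beyond `b`. -/
def NonTurbulent (f : ℝ → ℝ) : Prop :=
  ∀ (n : ℕ) (p b c : ℝ), f^[n] p = p → f^[n] b = p →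
    (b < c → c < p → b < f^[n] c) ∧ (p < c → c < b → f^[n] c < b)

/-- The conjugate of `f` by the reflection `t ↦ -t`. -/
def reflectMap (f : ℝ → ℝ) : ℝ → ℝ := fun t => -f (-t)

lemma reflectMap_iterate (f : ℝ → ℝ) (n : ℕ) (t : ℝ) : (reflectMap f)^[n] t = -f^[n] (-t) := by
  induction n generalizing t with
  | zero => simp
  | succ n ih => rw [Function.iterate_succ_apply, Function.iterate_succ_apply, ih]; simp [reflectMap]

lemma Continuous.conj_neg {f : ℝ → ℝ} (hf : Continuous f) : Continuous (reflectMap f) := by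
  unfold reflectMap; fun_prop

lemma NonTurbulent.conj_neg {f : ℝ → ℝ} (hf : NonTurbulent f) : NonTurbulent (reflectMap f) := by
  intro n p b c hp hb
  rw [reflectMap_iterate] at hp hb ⊢
  obtain ⟨h₁, h₂⟩ := hf n (-p) (-b) (-c) (by linarith) (by linarith)
  constructor
  · intro h h'
    linarith [h₂ (by linarith) (by linarith)]
  · intro h h'
    linarith [h₁ (by linarith) (by linarith)]

lemma NonTurbulent.iterate {f : ℝ → ℝ} (hf : NonTurbulent f) (N : ℕ) :
    NonTurbulent (f^[N]) := by
  intro n p b c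
  rw [← Function.iterate_mul]
  exact hf (N * n) p b c

lemma NonTurbulent.lt_iterate_of_lt {f : ℝ → ℝ} (hf : NonTurbulent f) (hc : Continuous f)
    {p y : ℝ} (hp : f p = p) (hpy : p < y) (hy : y < f y) (n : ℕ) : p < f^[n] y := by
  have key : ∀ k : ℕ, ∃ c, p < c ∧ c < y ∧ f^[k + 1] c = y := by
    intro k
    induction k with
    | zero =>
      obtain ⟨c, hcm, hcy⟩ := intermediate_value_Ioo hpy.le hc.continuousOn
        (show y ∈ Set.Ioo (f p) (f y) from ⟨by linarith, hy⟩)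
      exact ⟨c, hcm.1, hcm.2, hcy⟩
    | succ k ih =>
      obtain ⟨d, hpd, hdy, hd⟩ := ih
      obtain ⟨c, hcm, hcy⟩ := intermediate_value_Ioo hpy.le hc.continuousOn
        (show d ∈ Set.Ioo (f p) (f y) from ⟨by linarith, hdy.trans hy⟩)
      exact ⟨c, hcm.1, hcm.2, by rw [Function.iterate_succ_apply, hcy, hd]⟩
  by_contra! hn
  rcases n with _ | n
  · exact absurd hn (not_le.2 hpy)
  obtain ⟨c, hpc, hcy, hcc⟩ := key n
  obtain ⟨b, hb, hbp⟩ := intermediate_value_Icc' hcy.le (hc.iterate (n + 1)).continuousOn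
    (show p ∈ Set.Icc (f^[n + 1] y) (f^[n + 1] c) from ⟨hn, by rw [hcc]; exact hpy.le⟩)
  have hcb : c < b := lt_of_le_of_ne hb.1 (by rintro rfl; linarith)
  have := (hf (n + 1) p b c (Function.iterate_fixed hp _) hbp).2 hpc hcb
  linarith [hb.2]

lemma NonTurbulent.iterate_lt_of_lt {f : ℝ → ℝ} (hf : NonTurbulent f) (hc : Continuous f)
    {p y : ℝ} (hp : f p = p) (hpy : y < p) (hy : f y < y) (n : ℕ) : f^[n] y < p := by
  have := hf.conj_neg.lt_iterate_of_lt hc.conj_neg (p := -p) (y := -y) (by simp [reflectMap, hp])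
    (by linarith) (by simpa [reflectMap] using hy) n
  rw [reflectMap_iterate, neg_neg] at this
  linarith

/-- Points of an orbit that move up lie below those that move down. -/
lemma NonTurbulent.up_lt_down {f : ℝ → ℝ} (hf : NonTurbulent f) (hc : Continuous f)
    {x : ℝ} {m n : ℕ} (hm : f^[m] x < f^[m + 1] x) (hn : f^[n + 1] x < f^[n] x) :
    f^[m] x < f^[n] x := by
  rw [Function.iterate_succ_apply'] at hm hn
  by_contra! h
  have hlt : f^[n] x < f^[m] x := lt_of_le_of_ne h (by intro h; rw [h] at hn; linarith)
  obtain ⟨q, hq, hq0⟩ := intermediate_value_Ioo hlt.le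
    (f := fun t => f t - t) (by fun_prop)
    (show (0 : ℝ) ∈ Set.Ioo (f (f^[n] x) - f^[n] x) (f (f^[m] x) - f^[m] x) from
      ⟨by linarith, by linarith⟩)
  have hqf : f q = q := by simpa [sub_eq_zero] using hq0
  rcases le_total m n with hmn | hmn
  · obtain ⟨k, rfl⟩ := Nat.exists_eq_add_of_le' hmn
    have := hf.lt_iterate_of_lt hc hqf hq.2 hm k
    rw [← Function.iterate_add_apply] at this
    linarith [hq.1]
  · obtain ⟨k, rfl⟩ := Nat.exists_eq_add_of_le' hmn
    have := hf.iterate_lt_of_lt hc hqf hq.1 hn k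
    rw [← Function.iterate_add_apply] at this
    linarith [hq.2]

/-- If the orbit of `x`, whose points move towards the fixed point `p`, does not eventually
stay below `p` and infinitely often makes two consecutive visits below `p`, then it
converges to `p`. -/
lemma NonTurbulent.tendsto_of_frequently_below {f : ℝ → ℝ} (hf : NonTurbulent f)
    (hc : Continuous f) {x p : ℝ} (hp : f p = p) (hne : ∀ n, f^[n] x ≠ p)
    (hup : ∀ n, f^[n] x < p → f^[n] x < f^[n + 1] x)
    (hdown : ∀ n, p < f^[n] x → f^[n + 1] x < f^[n] x)
    (habove : ∃ᶠ n in atTop, p < f^[n] x)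
    (hbelow : ∃ᶠ n in atTop, f^[n] x < p ∧ f^[n + 1] x < p) :
    Tendsto (fun n => f^[n] x) atTop (nhds p) := by
  have late : ∀ N, ∃ m ≥ N, f^[m] x < p ∧ f^[m + 1] x < p ∧ p < f^[m + 2] x := by
    intro N
    obtain ⟨m₀, hm₀, h₀, h₁⟩ := (frequently_atTop.1 hbelow) N
    obtain ⟨m₁, hm₁, h₂⟩ := (frequently_atTop.1 habove) (m₀ + 2)
    by_contra! H
    have : ∀ k, f^[m₀ + k] x < p ∧ f^[m₀ + k + 1] x < p := by
      intro k
      induction k with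
      | zero => exact ⟨h₀, h₁⟩
      | succ k ih =>
        exact ⟨ih.2, lt_of_le_of_ne (H (m₀ + k) (by omega) ih.1 ih.2) (hne _)⟩
    have := (this (m₁ - m₀)).1
    rw [Nat.add_sub_cancel' (by omega)] at this
    linarith
  -- an orbit entering the gap between `p` and one of its preimages `b` stays above `b`
  have trap : ∀ b, b < p → f b = p → ∀ m, b < f^[m] x → f^[m] x < p → ∀ k ≥ m, b < f^[k] x := by
    intro b _ hb m h₁ h₂ k hk
    obtain ⟨j, rfl⟩ := Nat.exists_eq_add_of_le' hk
    rcases j with _ | j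
    · simpa using h₁
    rw [Function.iterate_add_apply]
    refine (hf (j + 1) p b _ (Function.iterate_fixed hp _) ?_).1 h₁ h₂
    rw [Function.iterate_succ_apply, hb, Function.iterate_fixed hp]
  let S : Set ℝ := {b | b < p ∧ f b = p ∧ ∀ᶠ k in atTop, b < f^[k] x}
  have newS : ∀ m, f^[m] x < p → f^[m + 1] x < p → p < f^[m + 2] x →
      ∃ b ∈ S, f^[m] x < b := by
    intro m h₀ h₁ h₂
    obtain ⟨b, hb, hbp⟩ := intermediate_value_Ioo (hup m h₀).le hc.continuousOn
      (show p ∈ Set.Ioo (f (f^[m] x)) (f (f^[m + 1] x)) by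
        rw [← Function.iterate_succ_apply' f m, ← Function.iterate_succ_apply' f (m + 1)]; exact ⟨h₁, h₂⟩)
    have hbp' : b < p := hb.2.trans h₁
    refine ⟨b, ⟨hbp', hbp, ?_⟩, hb.1⟩
    filter_upwards [eventually_ge_atTop (m + 1)] with k hk
    exact trap b hbp' hbp (m + 1) hb.2 h₁ k hk
  have hSne : S.Nonempty := by
    obtain ⟨m, -, h₀, h₁, h₂⟩ := late 0
    obtain ⟨b, hb, -⟩ := newS m h₀ h₁ h₂
    exact ⟨b, hb⟩
  have hSbdd : BddAbove S := ⟨p, fun b hb => hb.1.le⟩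
  have hr : f (sSup S) = p := by
    have h₁ : S ⊆ f ⁻¹' {p} := fun b hb => hb.2.1
    exact (isClosed_singleton.preimage hc).closure_subset_iff.2 h₁ (csSup_mem_closure hSne hSbdd)
  have hrp : sSup S = p := by
    by_contra hne'
    have hlt : sSup S < p := lt_of_le_of_ne (csSup_le hSne fun b hb => hb.1.le) hne'
    have hnear : ∀ᶠ t in nhds (sSup S), sSup S < f t :=
      hc.continuousAt.eventually (lt_mem_nhds (by rw [hr]; exact hlt))
    obtain ⟨δ, hδ, hball⟩ := Metric.eventually_nhds_iff.1 hnear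
    obtain ⟨b, hbS, hb⟩ := exists_lt_of_lt_csSup hSne (show sSup S - δ < sSup S by linarith)
    obtain ⟨N, hN⟩ := eventually_atTop.1 hbS.2.2
    obtain ⟨m, hm, h₀, h₁, h₂⟩ := late N
    obtain ⟨b', hb'S, hb'⟩ := newS m h₀ h₁ h₂
    have hmr : f^[m] x < sSup S := hb'.trans_le (le_csSup hSbdd hb'S)
    have hfm : sSup S < f^[m + 1] x := by
      rw [Function.iterate_succ_apply']
      apply hball
      rw [Real.dist_eq, abs_lt]
      constructor <;> linarith [hN m hm]
    obtain ⟨m', hm', h₀', h₁', h₂'⟩ := late (m + 1)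
    obtain ⟨b'', hb''S, hb''⟩ := newS m' h₀' h₁' h₂'
    have := trap _ hlt hr (m + 1) hfm h₁ m' hm'
    linarith [le_csSup hSbdd hb''S]
  have hlow : ∀ ε > 0, ∀ᶠ k in atTop, p - ε < f^[k] x := by
    intro ε hε
    obtain ⟨b, hbS, hb⟩ := exists_lt_of_lt_csSup hSne (show p - ε < sSup S by linarith)
    filter_upwards [hbS.2.2] with k hk
    linarith
  rw [Metric.tendsto_atTop]
  intro ε hε
  have hnear : ∀ᶠ t in nhds p, f t < p + ε :=
    hc.continuousAt.eventually (gt_mem_nhds (by rw [hp]; linarith))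
  obtain ⟨δ, hδ, hball⟩ := Metric.eventually_nhds_iff.1 hnear
  obtain ⟨N, hN⟩ := eventually_atTop.1 ((hlow ε hε).and (hlow δ hδ))
  obtain ⟨k₀, hk₀, hk₀p, -⟩ := (frequently_atTop.1 hbelow) N
  have hhigh : ∀ j, f^[k₀ + j] x < p + ε := by
    intro j
    induction j with
    | zero => simpa using hk₀p.trans (by linarith)
    | succ j ih =>
      rcases lt_or_gt_of_ne (hne (k₀ + j)) with h | h
      · rw [← add_assoc, Function.iterate_succ_apply']
        apply hball
        rw [Real.dist_eq, abs_lt]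
        constructor <;> linarith [(hN (k₀ + j) (by omega)).2]
      · have := hdown _ h
        rw [← add_assoc]
        linarith
  refine ⟨k₀, fun k hk => ?_⟩
  have h₁ := hhigh (k - k₀)
  rw [Nat.add_sub_cancel' hk] at h₁
  rw [Real.dist_eq, abs_lt]
  constructor <;> linarith [(hN k (by omega)).1]

lemma NonTurbulent.tendsto_of_frequently_above {f : ℝ → ℝ} (hf : NonTurbulent f)
    (hc : Continuous f) {x p : ℝ} (hp : f p = p) (hne : ∀ n, f^[n] x ≠ p)
    (hup : ∀ n, f^[n] x < p → f^[n] x < f^[n + 1] x)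
    (hdown : ∀ n, p < f^[n] x → f^[n + 1] x < f^[n] x)
    (hbelow : ∃ᶠ n in atTop, f^[n] x < p)
    (habove : ∃ᶠ n in atTop, p < f^[n] x ∧ p < f^[n + 1] x) :
    Tendsto (fun n => f^[n] x) atTop (nhds p) := by
  have := hf.conj_neg.tendsto_of_frequently_below hc.conj_neg (x := -x) (p := -p)
    (by simp [reflectMap, hp]) (by simpa [reflectMap_iterate] using hne)
    (by simpa [reflectMap_iterate] using hdown) (by simpa [reflectMap_iterate] using hup)
    (by simpa [reflectMap_iterate] using hbelow) (by simpa [reflectMap_iterate] using habove)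
  simpa [reflectMap_iterate] using this.neg

/-- A bounded orbit of a map without turbulent iterates either converges or eventually alternates
between the two sides of some point. -/
lemma NonTurbulent.tendsto_or_alternate {f : ℝ → ℝ} (hf : NonTurbulent f)
    (hc : Continuous f) {a b x : ℝ} (hx : ∀ n, f^[n] x ∈ Set.Icc a b) :
    (∃ l, Tendsto (fun n => f^[n] x) atTop (nhds l)) ∨
    (∃ p, ∀ᶠ n in atTop, f^[2 * n] x ≤ p ∧ p ≤ f^[2 * n + 1] x) ∨
    (∃ p, ∀ᶠ n in atTop, f^[2 * n + 1] x ≤ p ∧ p ≤ f^[2 * n] x) := by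
  by_cases hfix : ∃ n, f^[n + 1] x = f^[n] x
  · obtain ⟨n, hn⟩ := hfix
    rw [Function.iterate_succ_apply'] at hn
    refine Or.inl ⟨f^[n] x, tendsto_const_nhds.congr' ?_⟩
    filter_upwards [eventually_ge_atTop n] with k hk
    obtain ⟨j, rfl⟩ := Nat.exists_eq_add_of_le' hk
    rw [Function.iterate_add_apply, Function.iterate_fixed hn]
  push Not at hfix
  by_cases hU : ∃ᶠ n in atTop, f^[n] x < f^[n + 1] x
  swap
  · left
    obtain ⟨N, hN⟩ := eventually_atTop.1 (not_frequently.1 hU)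
    have hanti : Antitone fun n => f^[n + N] x := antitone_nat_of_succ_le fun n => by
      have := hN (n + N) (by omega)
      rw [show n + 1 + N = n + N + 1 by ring]
      exact not_lt.1 this
    have := tendsto_atTop_ciInf hanti ⟨a, by rintro _ ⟨n, rfl⟩; exact (hx _).1⟩
    exact ⟨_, (tendsto_add_atTop_iff_nat N).1 this⟩
  by_cases hD : ∃ᶠ n in atTop, f^[n + 1] x < f^[n] x
  swap
  · left
    obtain ⟨N, hN⟩ := eventually_atTop.1 (not_frequently.1 hD)
    have hmono : Monotone fun n => f^[n + N] x := monotone_nat_of_le_succ fun n => by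
      have := hN (n + N) (by omega)
      rw [show n + 1 + N = n + N + 1 by ring]
      exact not_lt.1 this
    have := tendsto_atTop_ciSup hmono ⟨b, by rintro _ ⟨n, rfl⟩; exact (hx _).2⟩
    exact ⟨_, (tendsto_add_atTop_iff_nat N).1 this⟩
  obtain ⟨p, hp, hUp, hDp⟩ : ∃ p, f p = p ∧ (∀ n, f^[n] x < f^[n + 1] x → f^[n] x ≤ p) ∧
      (∀ n, f^[n + 1] x < f^[n] x → p ≤ f^[n] x) := by
    let U : Set ℝ := {t | ∃ n, f^[n] x < f^[n + 1] x ∧ f^[n] x = t}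
    let D : Set ℝ := {t | ∃ n, f^[n + 1] x < f^[n] x ∧ f^[n] x = t}
    have hUD : ∀ u ∈ U, ∀ d ∈ D, u ≤ d := by
      rintro _ ⟨m, hm, rfl⟩ _ ⟨n, hn, rfl⟩
      exact (hf.up_lt_down hc hm hn).le
    have hUne : U.Nonempty := by obtain ⟨n, hn⟩ := hU.exists; exact ⟨_, n, hn, rfl⟩
    have hDne : D.Nonempty := by obtain ⟨n, hn⟩ := hD.exists; exact ⟨_, n, hn, rfl⟩
    have hUb : BddAbove U := ⟨b, by rintro _ ⟨n, -, rfl⟩; exact (hx n).2⟩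
    have hDb : BddBelow D := ⟨a, by rintro _ ⟨n, -, rfl⟩; exact (hx n).1⟩
    have hst : sSup U ≤ sInf D := csSup_le hUne fun u hu => le_csInf hDne fun d hd => hUD u hu d hd
    have hs : sSup U ≤ f (sSup U) := by
      have h₁ : U ⊆ {t | t ≤ f t} := by
        rintro _ ⟨n, hn, rfl⟩
        rw [Function.iterate_succ_apply'] at hn
        exact hn.le
      exact (isClosed_le continuous_id hc).closure_subset_iff.2 h₁ (csSup_mem_closure hUne hUb)
    have ht : f (sInf D) ≤ sInf D := by
      have h₁ : D ⊆ {t | f t ≤ t} := by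
        rintro _ ⟨n, hn, rfl⟩
        rw [Function.iterate_succ_apply'] at hn
        exact hn.le
      exact (isClosed_le hc continuous_id).closure_subset_iff.2 h₁ (csInf_mem_closure hDne hDb)
    obtain ⟨p, hpm, hp0⟩ := intermediate_value_Icc' hst
      (f := fun t => f t - t) (by fun_prop)
      (show (0 : ℝ) ∈ Set.Icc (f (sInf D) - sInf D) (f (sSup U) - sSup U) from
        ⟨by linarith, by linarith⟩)
    refine ⟨p, by simpa [sub_eq_zero] using hp0, fun n hn => ?_, fun n hn => ?_⟩
    · exact (le_csSup hUb ⟨n, hn, rfl⟩).trans hpm.1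
    · exact hpm.2.trans (csInf_le hDb ⟨n, hn, rfl⟩)
  have hne : ∀ n, f^[n] x ≠ p := by
    intro n h
    apply hfix n
    rw [Function.iterate_succ_apply', h, hp]
  have hup : ∀ n, f^[n] x < p → f^[n] x < f^[n + 1] x := by
    intro n h
    rcases lt_or_gt_of_ne (hfix n) with h' | h'
    · linarith [hDp n h']
    · exact h'
  have hdown : ∀ n, p < f^[n] x → f^[n + 1] x < f^[n] x := by
    intro n h
    rcases lt_or_gt_of_ne (hfix n) with h' | h'
    · exact h'
    · linarith [hUp n h']
  have hUf : ∃ᶠ n in atTop, f^[n] x < p := hU.mono fun n hn => lt_of_le_of_ne (hUp n hn) (hne n)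
  have hDf : ∃ᶠ n in atTop, p < f^[n] x :=
    hD.mono fun n hn => lt_of_le_of_ne (hDp n hn) (hne n).symm
  by_cases hUU : ∃ᶠ n in atTop, f^[n] x < p ∧ f^[n + 1] x < p
  · exact Or.inl ⟨p, hf.tendsto_of_frequently_below hc hp hne hup hdown hDf hUU⟩
  by_cases hDD : ∃ᶠ n in atTop, p < f^[n] x ∧ p < f^[n + 1] x
  · exact Or.inl ⟨p, hf.tendsto_of_frequently_above hc hp hne hup hdown hUf hDD⟩
  right
  obtain ⟨N, hN⟩ := eventually_atTop.1 ((not_frequently.1 hUU).and (not_frequently.1 hDD))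
  have hflip : ∀ n ≥ N, f^[n] x < p → p < f^[n + 1] x := fun n hn h =>
    lt_of_le_of_ne (not_lt.1 fun h' => (hN n hn).1 ⟨h, h'⟩) (hne _).symm
  have hflop : ∀ n ≥ N, p < f^[n] x → f^[n + 1] x < p := fun n hn h =>
    lt_of_le_of_ne (not_lt.1 fun h' => (hN n hn).2 ⟨h, h'⟩) (hne _)
  rcases lt_or_gt_of_ne (hne (2 * N)) with h | h
  · left
    have : ∀ j, f^[2 * (N + j)] x < p := by
      intro j
      induction j with
      | zero => exact h
      | succ j ih => exact hflop (2 * (N + j) + 1) (by omega) (hflip (2 * (N + j)) (by omega) ih)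
    refine ⟨p, ?_⟩
    filter_upwards [eventually_ge_atTop N] with n hn
    obtain ⟨j, rfl⟩ := Nat.exists_eq_add_of_le hn
    exact ⟨(this j).le, (hflip _ (by omega) (this j)).le⟩
  · right
    have : ∀ j, p < f^[2 * (N + j)] x := by
      intro j
      induction j with
      | zero => exact h
      | succ j ih => exact hflip (2 * (N + j) + 1) (by omega) (hflop (2 * (N + j)) (by omega) ih)
    refine ⟨p, ?_⟩
    filter_upwards [eventually_ge_atTop N] with n hn
    obtain ⟨j, rfl⟩ := Nat.exists_eq_add_of_le hn
    exact ⟨(hflop _ (by omega) (this j)).le, (this j).le⟩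

/-- Two separated sets, each of which is stretched by an iterate of `f` over both, force positive
entropy. -/
lemma coverEntropy_pos_of_horseshoe {f : ℝ → ℝ} {I : Set ℝ} {N : ℕ} {J : Bool → Set ℝ} {η : ℝ}
    (hη : 0 < η) (hJI : ∀ i, J i ⊆ I) (hne : ∀ i, (J i).Nonempty)
    (hsep : ∀ i j, i ≠ j → ∀ u ∈ J i, ∀ v ∈ J j, η ≤ |u - v|)
    (hcov : ∀ i j, ∀ y ∈ J i, ∃ u ∈ J j, f^[N] u = y) :
    0 < coverEntropy f I := by
  have hN : 0 < N := by
    rcases Nat.eq_zero_or_pos N with rfl | h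
    · obtain ⟨y, hy⟩ := hne true
      obtain ⟨u, hu, huy⟩ := hcov true false y hy
      have := hsep true false (by simp) y hy u hu
      rw [← huy] at this
      simp at this
      linarith
    · exact h
  have word : ∀ (n : ℕ) (w : ℕ → Bool), ∃ y ∈ J (w 0), ∀ i < n, f^[N * i] y ∈ J (w i) := by
    intro n
    induction n with
    | zero =>
      intro w
      obtain ⟨y, hy⟩ := hne (w 0)
      exact ⟨y, hy, by simp⟩
    | succ n ih =>
      intro w
      obtain ⟨y', hy', hi⟩ := ih fun i => w (i + 1)
      obtain ⟨y, hy, hyy⟩ := hcov _ (w 0) y' hy'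
      refine ⟨y, hy, fun i hin => ?_⟩
      rcases i with _ | i
      · simpa using hy
      · rw [Nat.mul_succ, Function.iterate_add_apply, hyy]
        exact hi i (by omega)
  let U : SetRel ℝ ℝ := {p | dist p.1 p.2 < η / 2}
  have hU : U ∈ uniformity ℝ := Metric.dist_mem_uniformity (by linarith)
  have hcard : ∀ n : ℕ, ((2 ^ n : ℕ) : ℕ∞) ≤ netMaxcard f I U (N * n) := by
    intro n
    choose Y hY0 hY using word n
    let ext : (Fin n → Bool) → ℕ → Bool := fun w i => if h : i < n then w ⟨i, h⟩ else true
    have hdisj : ∀ w w' : Fin n → Bool, w ≠ w' → ∀ z,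
        z ∈ UniformSpace.ball (Y (ext w)) (dynEntourage f U (N * n)) →
        z ∉ UniformSpace.ball (Y (ext w')) (dynEntourage f U (N * n)) := by
      intro w w' hww z hz hz'
      obtain ⟨i, hi⟩ := Function.ne_iff.1 hww
      have h₁ := hY (ext w) i i.2
      have h₂ := hY (ext w') i i.2
      have e₁ : ext w i = w i := by simp [ext]
      have e₂ : ext w' i = w' i := by simp [ext]
      rw [e₁] at h₁
      rw [e₂] at h₂
      have hlt : N * (i : ℕ) < N * n := Nat.mul_lt_mul_of_pos_left i.2 hN
      have hd₁ : dist _ _ < η / 2 := mem_dynEntourage.1 hz _ hlt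
      have hd₂ : dist _ _ < η / 2 := mem_dynEntourage.1 hz' _ hlt
      have := hsep _ _ hi _ h₁ _ h₂
      rw [← Real.dist_eq] at this
      have := dist_triangle_right (f^[N * i] (Y (ext w))) (f^[N * i] (Y (ext w')))
        (f^[N * i] z)
      linarith
    have hself : ∀ y, y ∈ UniformSpace.ball y (dynEntourage f U (N * n)) := fun y =>
      mem_dynEntourage.2 fun k _ => by
        change dist _ _ < η / 2
        rw [dist_self]; linarith
    have hinj : Function.Injective fun w => Y (ext w) := by
      intro w w' h
      by_contra hww
      apply hdisj w w' hww (Y (ext w)) (hself _)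
      rw [show Y (ext w) = Y (ext w') from h]
      exact hself _
    let s : Finset ℝ := Finset.univ.map ⟨_, hinj⟩
    have hs : IsDynNetIn f I U (N * n) s := by
      constructor
      · intro y hy
        simp only [s, Finset.coe_map, Set.mem_image] at hy
        obtain ⟨w, -, rfl⟩ := hy
        exact hJI _ (hY0 _)
      · intro y hy y' hy' hyy
        simp only [s, Finset.coe_map, Set.mem_image] at hy hy'
        obtain ⟨w, -, rfl⟩ := hy
        obtain ⟨w', -, rfl⟩ := hy'
        exact Set.disjoint_left.2 (hdisj w w' (by rintro rfl; exact hyy rfl))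
    have := hs.card_le_netMaxcard
    simpa [s] using this
  refine lt_of_lt_of_le ?_ (netEntropyEntourage_le_coverEntropy f I hU)
  have hpos : (0 : EReal) < ((Real.log 2 / N : ℝ) : EReal) := by
    exact_mod_cast div_pos (Real.log_pos one_lt_two) (by exact_mod_cast hN)
  refine hpos.trans_le ?_
  refine le_limsup_of_frequently_le (frequently_atTop.2 fun m => ⟨N * (m + 1), by nlinarith, ?_⟩)
  have hposn : (0 : EReal) < ((N * (m + 1) : ℕ) : EReal) := by
    exact_mod_cast Nat.mul_pos hN (Nat.succ_pos m)
  rw [EReal.le_div_iff_mul_le hposn (EReal.natCast_ne_top _)]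
  have hlog : ((((2 ^ (m + 1) : ℕ) : ℕ∞) : ENNReal)).log ≤
      (((netMaxcard f I U (N * (m + 1)) : ℕ∞) : ENNReal)).log := by
    apply ENNReal.log_monotone
    exact_mod_cast hcard (m + 1)
  refine le_trans (le_of_eq ?_) hlog
  have h2 : (((2 ^ (m + 1) : ℕ) : ℕ∞) : ENNReal) = ENNReal.ofReal (2 ^ (m + 1)) := by
    rw [ENNReal.ofReal_pow (by norm_num)]
    simp
  rw [h2, ENNReal.log_ofReal_of_pos (by positivity), Real.log_pow]
  have : (((N * (m + 1) : ℕ) : ℝ) : EReal) = ((N * (m + 1) : ℕ) : EReal) := by norm_cast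
  rw [← this, ← EReal.coe_mul]
  congr 1
  have : (N : ℝ) ≠ 0 := by exact_mod_cast hN.ne'
  push_cast
  field_simp

/-- A turbulent iterate forces positive entropy. -/
lemma coverEntropy_pos_of_turbulent {f F : ℝ → ℝ} {l r : ℝ}
    (hF : Continuous F) (hiter : ∀ n, ∀ y ∈ Set.Icc l r, f^[n] y = F^[n] y)
    {n : ℕ} {p b c : ℝ} (hp : F^[n] p = p) (hb : F^[n] b = p)
    (hpI : p ∈ Set.Icc l r) (hbI : b ∈ Set.Icc l r)
    (h : (b < c ∧ c < p ∧ F^[n] c ≤ b) ∨ (p < c ∧ c < b ∧ b ≤ F^[n] c)) :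
    0 < coverEntropy f (Set.Icc l r) := by
  have hH : Continuous F^[n] := hF.iterate n
  have hcb : c ∈ Set.uIcc b p := by
    rcases h with h | h <;> simp only [Set.mem_uIcc]
    · exact Or.inl ⟨h.1.le, h.2.1.le⟩
    · exact Or.inr ⟨h.1.le, h.2.1.le⟩
  have hbc : b ∈ Set.uIcc (F^[n] c) p := by
    rcases h with h | h <;> simp only [Set.mem_uIcc]
    · exact Or.inl ⟨h.2.2, by linarith⟩
    · exact Or.inr ⟨by linarith, h.2.2⟩
  obtain ⟨d, hdm, hd⟩ : ∃ d ∈ Set.uIcc b c, F^[n] d = c := by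
    apply intermediate_value_uIcc hH.continuousOn
    rw [hb, Set.uIcc_comm]
    exact Set.uIcc_subset_uIcc hbc Set.right_mem_uIcc hcb
  have hdc : d ≠ c := by
    rintro rfl
    rcases h with h | h <;> linarith
  have hcov : ∀ y ∈ Set.uIcc b p, ∃ u ∈ Set.uIcc c p, F^[n] u = y := by
    intro y hy
    apply intermediate_value_uIcc hH.continuousOn
    rw [hp]
    exact Set.uIcc_subset_uIcc hbc Set.right_mem_uIcc hy
  have hcov' : ∀ y ∈ Set.uIcc c p, ∃ u ∈ Set.uIcc b d, F^[n] u = y := by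
    intro y hy
    apply intermediate_value_uIcc hH.continuousOn
    rwa [hb, hd, Set.uIcc_comm]
  have hright : Set.uIcc c p ⊆ Set.uIcc b p := Set.uIcc_subset_uIcc hcb Set.right_mem_uIcc
  have hleft : Set.uIcc b d ⊆ Set.uIcc b p := Set.uIcc_subset_uIcc Set.left_mem_uIcc
    (Set.uIcc_subset_uIcc Set.left_mem_uIcc hcb hdm)
  have hI : Set.uIcc b p ⊆ Set.Icc l r := Set.uIcc_subset_Icc hbI hpI
  have hsep : ∀ u ∈ Set.uIcc b d, ∀ v ∈ Set.uIcc c p, |d - c| ≤ |u - v| := by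
    intro u hu v hv
    simp only [Set.mem_uIcc] at hu hv hdm
    rcases h with h | h
    · rw [abs_of_nonpos (by grind), abs_of_nonpos (by grind)]; grind
    · rw [abs_of_nonneg (by grind), abs_of_nonneg (by grind)]; grind
  refine coverEntropy_pos_of_horseshoe (N := n + n)
    (J := fun i => if i then Set.uIcc b d else Set.uIcc c p)
    (abs_pos.2 (sub_ne_zero.2 hdc)) ?_ ?_ ?_ ?_
  · rintro (_ | _)
    · simpa using hright.trans hI
    · simpa using hleft.trans hI
  · rintro (_ | _)
    · simp
    · simp
  · rintro (_ | _) (_ | _) hij u hu v hv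
    · exact absurd rfl hij
    · rw [abs_sub_comm u v]
      exact hsep v (by simpa using hv) u (by simpa using hu)
    · exact hsep u (by simpa using hu) v (by simpa using hv)
    · exact absurd rfl hij
  · intro i j y hy
    have hy' : y ∈ Set.uIcc b p := by
      cases i
      · exact hright (by simpa using hy)
      · exact hleft (by simpa using hy)
    obtain ⟨v, hv, hvy⟩ := hcov y hy'
    cases j
    · obtain ⟨u, hu, huv⟩ := hcov v (hright hv)
      refine ⟨u, by simpa using hu, ?_⟩
      rw [hiter _ _ (hI (hright hu)), Function.iterate_add_apply, huv, hvy]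
    · obtain ⟨u, hu, huv⟩ := hcov' v hv
      refine ⟨u, by simpa using hu, ?_⟩
      rw [hiter _ _ (hI (hleft hu)), Function.iterate_add_apply, huv, hvy]

lemma nonTurbulent_of_coverEntropy_eq_zero {f F : ℝ → ℝ} {l r : ℝ}
    (hF : Continuous F) (hFI : ∀ t, F t ∈ Set.Icc l r)
    (hiter : ∀ n, ∀ y ∈ Set.Icc l r, f^[n] y = F^[n] y)
    (hent : coverEntropy f (Set.Icc l r) = 0) : NonTurbulent F := by
  intro n p b c hp hb
  rcases n with _ | n
  · simp only [Function.iterate_zero, id] at hb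
    constructor <;> intro h h' <;> linarith
  have hpI : p ∈ Set.Icc l r := by
    rw [← hp, Function.iterate_succ_apply']; exact hFI _
  have hcI : F^[n + 1] c ∈ Set.Icc l r := by
    rw [Function.iterate_succ_apply']; exact hFI _
  constructor
  · intro h h'
    by_contra! hc
    exact (coverEntropy_pos_of_turbulent hF hiter hp hb hpI
      ⟨hcI.1.trans hc, by linarith [hpI.2]⟩ (Or.inl ⟨h, h', hc⟩)).ne' hent
  · intro h h'
    by_contra! hc
    exact (coverEntropy_pos_of_turbulent hF hiter hp hb hpI
      ⟨by linarith [hpI.1], hc.trans hcI.2⟩ (Or.inr ⟨h, h', hc⟩)).ne' hent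

/-- The limit set of the orbit of `x` under `f` along the times congruent to `i` modulo `N`. -/
def residueLimit (f : ℝ → ℝ) (x : ℝ) (N i : ℕ) : Set ℝ :=
  {z | MapClusterPt z atTop fun n => f^[N * n + i] x}

lemma residueLimit_subset (f : ℝ → ℝ) (x : ℝ) (N i j : ℕ) {k : ℕ} (hk : 0 < k) :
    residueLimit f x (N * k) (N * j + i) ⊆ residueLimit f x N i := by
  intro z hz
  have hφ : Tendsto (fun n => k * n + j) atTop atTop :=
    (tendsto_add_atTop_nat j).comp (tendsto_id.const_mul_atTop' hk)
  refine MapClusterPt.of_comp hφ (MapClusterPt.congrFun (Eventually.of_forall fun n => ?_) hz)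
  simp only [Function.comp]
  rw [show N * k * n + (N * j + i) = N * (k * n + j) + i by ring]

lemma residueLimit_subset_of_modEq (f : ℝ → ℝ) (x : ℝ) (N j : ℕ) :
    residueLimit f x N j ⊆ residueLimit f x N (j % N) := by
  have := residueLimit_subset f x N (j % N) (j / N) one_pos
  rwa [mul_one, Nat.div_add_mod] at this

lemma iterate_mem_residueLimit {f : ℝ → ℝ} (hc : Continuous f) {x z : ℝ} {N i : ℕ}
    (hz : z ∈ residueLimit f x N i) (m : ℕ) : f^[m] z ∈ residueLimit f x N (i + m) := by
  refine MapClusterPt.congrFun (Eventually.of_forall fun n => ?_)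
    (MapClusterPt.continuousAt_comp (hc.iterate m).continuousAt hz)
  simp only [Function.comp]
  rw [← Function.iterate_add_apply, show m + (N * n + i) = N * n + (i + m) by ring]

lemma isClosed_residueLimit (f : ℝ → ℝ) (x : ℝ) (N i : ℕ) : IsClosed (residueLimit f x N i) :=
  isClosed_setOfPred_clusterPt

section Bounded

variable {f : ℝ → ℝ} {l r x : ℝ}

lemma residueLimit_subset_Icc (hx : ∀ n, f^[n] x ∈ Set.Icc l r) (N i : ℕ) :
    residueLimit f x N i ⊆ Set.Icc l r := fun _ hz =>
  isClosed_Icc.mem_of_mapClusterPt hz (Eventually.of_forall fun _ => hx _)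

lemma isBounded_residueLimit (hx : ∀ n, f^[n] x ∈ Set.Icc l r) (N i : ℕ) :
    Bornology.IsBounded (residueLimit f x N i) :=
  (Metric.isBounded_Icc l r).subset (residueLimit_subset_Icc hx N i)

lemma isCompact_residueLimit (hx : ∀ n, f^[n] x ∈ Set.Icc l r) (N i : ℕ) :
    IsCompact (residueLimit f x N i) :=
  isCompact_Icc.of_isClosed_subset (isClosed_residueLimit f x N i) (residueLimit_subset_Icc hx N i)

lemma exists_mem_residueLimit {z : ℝ} (hz : z ∈ residueLimit f x 1 0) {N : ℕ} (hN : 0 < N) :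
    ∃ i < N, z ∈ residueLimit f x N i := by
  by_contra! H
  have h₁ : ∀ i ∈ Finset.range N, ∃ s ∈ nhds z, ∀ᶠ n in atTop, f^[N * n + i] x ∉ s := by
    intro i hi
    have := H i (Finset.mem_range.1 hi)
    simp only [residueLimit, Set.mem_ofPred_eq, mapClusterPt_iff_frequently, not_forall,
      not_frequently] at this
    obtain ⟨s, hs, h⟩ := this
    exact ⟨s, hs, h⟩
  choose! s hs hev using h₁
  have h₂ := (Nat.tendsto_div_const_atTop hN.ne').eventually
    ((eventually_all_finset _).2 hev)
  have h₃ := mapClusterPt_iff_frequently.1 hz _ ((biInter_finset_mem _).2 hs)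
  obtain ⟨n, hn, hn'⟩ := (h₃.and_eventually h₂).exists
  have hm : n % N ∈ Finset.range N := Finset.mem_range.2 (Nat.mod_lt _ hN)
  apply hn' _ hm
  rw [Nat.div_add_mod]
  simpa using Set.mem_iInter₂.1 hn _ hm

lemma eventually_near_residueLimit (hx : ∀ n, f^[n] x ∈ Set.Icc l r) {N : ℕ} (hN : 0 < N)
    {η : ℝ} (hη : 0 < η) :
    ∀ᶠ n in atTop, ∃ w ∈ residueLimit f x N (n % N), |f^[n] x - w| < η := by
  have h₁ : ∀ i ∈ Finset.range N, ∀ᶠ n in atTop,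
      ∃ w ∈ residueLimit f x N i, |f^[N * n + i] x - w| < η := by
    intro i _
    by_contra H
    have hcomp : IsCompact (Set.Icc l r \ Metric.thickening η (residueLimit f x N i)) :=
      isCompact_Icc.diff Metric.isOpen_thickening
    obtain ⟨w, hw, hwc⟩ := hcomp.exists_mapClusterPt_of_frequently
      (l := atTop) (f := fun n => f^[N * n + i] x) (by
        refine (not_eventually.1 H).mono fun n hn => ⟨hx _, fun ht => hn ?_⟩
        obtain ⟨w, hw, hd⟩ := Metric.mem_thickening_iff.1 ht
        exact ⟨w, hw, by rwa [← Real.dist_eq]⟩)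
    exact hw.2 (Metric.self_subset_thickening hη _ hwc)
  have h₂ := (Nat.tendsto_div_const_atTop hN.ne').eventually
    ((eventually_all_finset _).2 h₁)
  filter_upwards [h₂] with n hn
  have := hn (n % N) (Finset.mem_range.2 (Nat.mod_lt _ hN))
  rwa [Nat.div_add_mod] at this

lemma NonTurbulent.residueLimit_double_ordered (hf : NonTurbulent f) (hc : Continuous f)
    (hx : ∀ n, f^[n] x ∈ Set.Icc l r) (N i : ℕ) :
    (∀ u ∈ residueLimit f x (N * 2) i, ∀ v ∈ residueLimit f x (N * 2) (i + N), u ≤ v) ∨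
    (∀ u ∈ residueLimit f x (N * 2) i, ∀ v ∈ residueLimit f x (N * 2) (i + N), v ≤ u) := by
  have e₁ : ∀ n, (f^[N])^[2 * n] (f^[i] x) = f^[N * 2 * n + i] x := fun n => by
    rw [← Function.iterate_mul, ← Function.iterate_add_apply, mul_assoc]
  have e₂ : ∀ n, (f^[N])^[2 * n + 1] (f^[i] x) = f^[N * 2 * n + (i + N)] x := fun n => by
    rw [← Function.iterate_mul, ← Function.iterate_add_apply,
      show N * (2 * n + 1) + i = N * 2 * n + (i + N) by ring]
  have hb : ∀ n, (f^[N])^[n] (f^[i] x) ∈ Set.Icc l r := fun n => by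
    rw [← Function.iterate_mul, ← Function.iterate_add_apply]
    exact hx _
  rcases (hf.iterate N).tendsto_or_alternate (hc.iterate N) hb with ⟨p, hp⟩ | ⟨p, hp⟩ | ⟨p, hp⟩
  · left
    intro u hu v hv
    have h2 : Tendsto (fun n : ℕ => 2 * n) atTop atTop := tendsto_id.const_mul_atTop' two_pos
    have t₁ := hp.comp h2
    have t₂ := hp.comp ((tendsto_add_atTop_nat 1).comp h2)
    simp only [Function.comp_def, e₁, e₂] at t₁ t₂
    have hu' : ClusterPt u _ := MapClusterPt.clusterPt hu
    have hv' : ClusterPt v _ := MapClusterPt.clusterPt hv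
    have hup := eq_of_nhds_neBot (hu'.mono t₁)
    have hvp := eq_of_nhds_neBot (hv'.mono t₂)
    rw [hup, hvp]
  · left
    intro u hu v hv
    simp only [e₁, e₂] at hp
    exact le_trans (isClosed_Iic.mem_of_mapClusterPt hu (hp.mono fun n h => h.1))
      (isClosed_Ici.mem_of_mapClusterPt hv (hp.mono fun n h => h.2))
  · right
    intro u hu v hv
    simp only [e₁, e₂] at hp
    exact le_trans (isClosed_Iic.mem_of_mapClusterPt hv (hp.mono fun n h => h.1))
      (isClosed_Ici.mem_of_mapClusterPt hu (hp.mono fun n h => h.2))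

/-- The limit sets along distinct residues modulo `2 ^ k` lie side by side. -/
lemma NonTurbulent.residueLimit_ordered (hf : NonTurbulent f) (hc : Continuous f)
    (hx : ∀ n, f^[n] x ∈ Set.Icc l r) (k : ℕ) {i j : ℕ} (hij : i % 2 ^ k ≠ j % 2 ^ k) :
    (∀ u ∈ residueLimit f x (2 ^ k) i, ∀ v ∈ residueLimit f x (2 ^ k) j, u ≤ v) ∨
    (∀ u ∈ residueLimit f x (2 ^ k) i, ∀ v ∈ residueLimit f x (2 ^ k) j, v ≤ u) := by
  induction k generalizing i j with
  | zero => simp [Nat.mod_one] at hij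
  | succ k ih =>
    wlog hle : i ≤ j generalizing i j with H
    · rcases H hij.symm (by omega) with h | h
      · exact Or.inr fun u hu v hv => h v hv u hu
      · exact Or.inl fun u hu v hv => h v hv u hu
    rw [pow_succ] at hij ⊢
    set N := 2 ^ k with hNdef
    by_cases hmod : i % N = j % N
    · obtain ⟨q, hq⟩ := (Nat.modEq_iff_dvd' hle).1 hmod
      have hqodd : q % 2 = 1 := by
        rcases Nat.mod_two_eq_zero_or_one q with h | h
        · exfalso
          apply hij
          refine (Nat.modEq_iff_dvd' hle).2 ?_
          rw [hq]
          exact Nat.mul_dvd_mul_left _ (Nat.dvd_of_mod_eq_zero h)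
        · exact h
      have hj : j = N * 2 * (q / 2) + (i + N) := by
        have h1 : j = i + N * q := by omega
        have h2 : q = 2 * (q / 2) + 1 := by omega
        rw [h1]
        conv_lhs => rw [h2]
        ring
      have hsub : residueLimit f x (N * 2) j ⊆ residueLimit f x (N * 2) (i + N) := by
        have := residueLimit_subset f x (N * 2) (i + N) (q / 2) one_pos
        rwa [mul_one, ← hj] at this
      rcases hf.residueLimit_double_ordered hc hx N i with h | h
      · exact Or.inl fun u hu v hv => h u hu v (hsub hv)
      · exact Or.inr fun u hu v hv => h u hu v (hsub hv)
    · have hsub : ∀ m, residueLimit f x (N * 2) m ⊆ residueLimit f x N m := fun m => by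
        have := residueLimit_subset f x N m 0 two_pos
        rwa [mul_zero, zero_add] at this
      rcases ih hmod with h | h
      · exact Or.inl fun u hu v hv => h u (hsub _ hu) v (hsub _ hv)
      · exact Or.inr fun u hu v hv => h u (hsub _ hu) v (hsub _ hv)

end Bounded

/-- Bounded sets of reals lying side by side in an interval have total diameter at most the length
of the interval. -/
lemma sum_diam_le_of_ordered {ι : Type*} (s : Finset ι) (M : ι → Set ℝ) {l r : ℝ} (hlr : l ≤ r)
    (hM : ∀ i ∈ s, M i ⊆ Set.Icc l r)
    (hord : ∀ i ∈ s, ∀ j ∈ s, i ≠ j →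
      (∀ u ∈ M i, ∀ v ∈ M j, u ≤ v) ∨ (∀ u ∈ M i, ∀ v ∈ M j, v ≤ u)) :
    ∑ i ∈ s, Metric.diam (M i) ≤ r - l := by
  classical
  have hrest : ∑ i ∈ s, Metric.diam (M i) = ∑ i ∈ s with (M i).Nonempty, Metric.diam (M i) := by
    rw [Finset.sum_filter]
    refine Finset.sum_congr rfl fun i _ => ?_
    split_ifs with h
    · rfl
    · rw [Set.not_nonempty_iff_eq_empty.1 h, Metric.diam_empty]
  rw [hrest]
  set t := {i ∈ s | (M i).Nonempty}
  have ht : ∀ i ∈ t, i ∈ s ∧ (M i).Nonempty := fun i hi => Finset.mem_filter.1 hi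
  have hbdd : ∀ i ∈ t, Bornology.IsBounded (M i) := fun i hi =>
    (Metric.isBounded_Icc l r).subset (hM i (ht i hi).1)
  let O : ι → Set ℝ := fun i => Set.Ioo (sInf (M i)) (sSup (M i))
  have hdisj : (t : Set ι).PairwiseDisjoint O := by
    intro i hi j hj hij
    have hi' := ht i hi
    have hj' := ht j hj
    refine Set.disjoint_left.2 fun z hz hz' => ?_
    rcases hord i hi'.1 j hj'.1 hij with h | h
    · have : sSup (M i) ≤ sInf (M j) :=
        csSup_le hi'.2 fun u hu => le_csInf hj'.2 fun v hv => h u hu v hv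
      linarith [hz.2, hz'.1]
    · have : sSup (M j) ≤ sInf (M i) :=
        csSup_le hj'.2 fun v hv => le_csInf hi'.2 fun u hu => h u hu v hv
      linarith [hz.1, hz'.2]
  have hsub : (⋃ i ∈ t, O i) ⊆ Set.Icc l r := by
    refine Set.iUnion₂_subset fun i hi z hz => ?_
    have hi' := ht i hi
    exact ⟨(le_csInf hi'.2 fun u hu => (hM i hi'.1 hu).1).trans hz.1.le,
      hz.2.le.trans (csSup_le hi'.2 fun u hu => (hM i hi'.1 hu).2)⟩
  have hvol := MeasureTheory.measure_mono (μ := MeasureTheory.volume) hsub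
  rw [MeasureTheory.measure_biUnion_finset hdisj fun i _ => measurableSet_Ioo,
    Real.volume_Icc] at hvol
  have hsum : ∑ i ∈ t, MeasureTheory.volume (O i) =
      ENNReal.ofReal (∑ i ∈ t, Metric.diam (M i)) := by
    rw [ENNReal.ofReal_sum_of_nonneg fun i _ => Metric.diam_nonneg]
    refine Finset.sum_congr rfl fun i hi => ?_
    rw [Real.volume_Ioo, Real.diam_eq (hbdd i hi)]
  rw [hsum] at hvol
  exact (ENNReal.ofReal_le_ofReal_iff (by linarith)).1 hvol

lemma NonTurbulent.sum_diam_residueLimit_le {f : ℝ → ℝ} {l r x : ℝ} (hf : NonTurbulent f)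
    (hc : Continuous f) (hx : ∀ n, f^[n] x ∈ Set.Icc l r) (k : ℕ) (e : ℕ → ℕ)
    (he : Set.InjOn (fun n => e n % 2 ^ k) (Finset.range (2 ^ k))) :
    ∑ n ∈ Finset.range (2 ^ k), Metric.diam (residueLimit f x (2 ^ k) (e n)) ≤ r - l :=
  sum_diam_le_of_ordered _ _ ((hx 0).1.trans (hx 0).2)
    (fun _ _ => residueLimit_subset_Icc hx _ _)
    (fun _ hm _ hn hmn => hf.residueLimit_ordered hc hx k fun h => hmn (he hm hn h))

/-- If the sums of `d` over consecutive blocks of length `N` are at most `D`, a sequence eventually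
bounded by `d + η` has upper mean at most `D / N + η`. -/
lemma limsup_mean_le_of_block_sum_le {u d : ℕ → ℝ} {C D η : ℝ} {N n₀ : ℕ} (hN : 0 < N)
    (hu : ∀ n, 0 ≤ u n) (huC : ∀ n, u n ≤ C) (hd : ∀ n, 0 ≤ d n) (hη : 0 ≤ η)
    (hsum : ∀ m, ∑ n ∈ Finset.range N, d (N * m + n) ≤ D)
    (hle : ∀ n ≥ n₀, u n ≤ d n + η) :
    limsup (fun T : ℕ => (∑ n ∈ Finset.Icc 1 T, u n) / T) atTop ≤ D / N + η := by
  have hD : 0 ≤ D := (Finset.sum_nonneg fun n _ => hd _).trans (hsum 0)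
  have hC : 0 ≤ C := (hu 0).trans (huC 0)
  have hblock : ∀ q, ∑ n ∈ Finset.range (N * q), d n ≤ D * q := by
    intro q
    induction q with
    | zero => simp
    | succ q ih =>
      rw [Nat.mul_succ, Finset.sum_range_add]
      push_cast
      linarith [hsum q]
  have hNR : (0 : ℝ) < N := by exact_mod_cast hN
  have hmain : ∀ T : ℕ, ∑ n ∈ Finset.Icc 1 T, u n ≤ C * n₀ + D * (T / N + 1) + η * T := by
    intro T
    have h₁ : ∀ n ∈ Finset.Icc 1 T, u n ≤ (if n < n₀ then C else 0) + d n + η := by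
      intro n _
      split_ifs with h
      · linarith [huC n, hd n]
      · linarith [hle n (by omega)]
    have h₂ : ∑ n ∈ Finset.Icc 1 T, (if n < n₀ then C else 0) ≤ C * n₀ := by
      rw [← Finset.sum_filter, Finset.sum_const, nsmul_eq_mul, mul_comm]
      have : {n ∈ Finset.Icc 1 T | n < n₀} ⊆ Finset.range n₀ := fun n hn =>
        Finset.mem_range.2 (Finset.mem_filter.1 hn).2
      have := Finset.card_le_card this
      rw [Finset.card_range] at this
      gcongr
    have h₃ : ∑ n ∈ Finset.Icc 1 T, d n ≤ D * (T / N + 1) := by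
      have hsub : Finset.Icc 1 T ⊆ Finset.range (N * (T / N + 1)) := fun n hn => by
        have := (Finset.mem_Icc.1 hn).2
        have := Nat.lt_mul_div_succ T hN
        exact Finset.mem_range.2 (by omega)
      refine (Finset.sum_le_sum_of_subset_of_nonneg hsub fun n _ _ => hd n).trans
        ((hblock _).trans ?_)
      push_cast
      gcongr
      exact Nat.cast_div_le
    have h₄ := Finset.sum_le_sum h₁
    rw [Finset.sum_add_distrib, Finset.sum_add_distrib, Finset.sum_const, Nat.card_Icc,
      nsmul_eq_mul, Nat.add_sub_cancel] at h₄
    linarith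
  have hlim : Tendsto (fun T : ℕ => (C * n₀ + D) / T + (D / N + η)) atTop
      (nhds (D / N + η)) := by
    simpa using (tendsto_const_div_atTop_nhds_zero_nat (C * n₀ + D)).add_const (D / N + η)
  rw [← hlim.limsup_eq]
  refine limsup_le_limsup ?_ ?_ hlim.isBoundedUnder_le
  · filter_upwards [eventually_gt_atTop 0] with T hT
    have hTR : (0 : ℝ) < T := by exact_mod_cast hT
    rw [div_le_iff₀ hTR]
    refine (hmain T).trans (le_of_eq ?_)
    field_simp
    ring
  · exact isCoboundedUnder_le_of_le atTop (x := 0) fun T =>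
      div_nonneg (Finset.sum_nonneg fun n _ => hu n) (Nat.cast_nonneg T)

/-- A nonempty compact invariant set contains a minimal one. -/
lemma exists_minimal_invariant_subset {F : ℝ → ℝ} (hF : Continuous F) {S : Set ℝ}
    (hS : IsCompact S) (hne : S.Nonempty) (hmaps : Set.MapsTo F S S) :
    ∃ K ⊆ S, K.Nonempty ∧ IsClosed K ∧ Set.MapsTo F K K ∧
      ∀ x ∈ K, K ⊆ closure (Set.range fun n : ℕ => F^[n] x) := by
  obtain ⟨K, hKS, hK⟩ := zorn_superset_nonempty
    {K : Set ℝ | K ⊆ S ∧ K.Nonempty ∧ IsClosed K ∧ Set.MapsTo F K K} (by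
      intro c hcS hchain hcne
      refine ⟨⋂₀ c, ⟨?_, ?_, ?_, ?_⟩, fun s hs => Set.sInter_subset_of_mem hs⟩
      · obtain ⟨s, hs⟩ := hcne
        exact (Set.sInter_subset_of_mem hs).trans (hcS hs).1
      · have : Nonempty c := hcne.to_subtype
        exact IsCompact.nonempty_sInter_of_directed_nonempty_isCompact_isClosed
          (fun s hs t ht => (hchain.total hs ht).elim (fun h => ⟨s, hs, subset_rfl, h⟩)
            fun h => ⟨t, ht, h, subset_rfl⟩) (fun s hs => (hcS hs).2.1)
          (fun s hs => hS.of_isClosed_subset (hcS hs).2.2.1 (hcS hs).1)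
          (fun s hs => (hcS hs).2.2.1)
      · exact isClosed_sInter fun s hs => (hcS hs).2.2.1
      · exact fun x hx s hs => (hcS hs).2.2.2 (hx s hs))
    S ⟨subset_rfl, hne, hS.isClosed, hmaps⟩
  obtain ⟨-, hKne, hKc, hKm⟩ := hK.prop
  refine ⟨K, hKS, hKne, hKc, hKm, fun x hx => ?_⟩
  have horb : closure (Set.range fun n : ℕ => F^[n] x) ⊆ K := by
    refine hKc.closure_subset_iff.2 ?_
    rintro _ ⟨n, rfl⟩
    exact hKm.iterate n hx
  refine hK.le_of_le ⟨horb.trans hKS, ?_, isClosed_closure, ?_⟩ horb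
  · exact ⟨x, subset_closure ⟨0, rfl⟩⟩
  · refine Set.MapsTo.closure ?_ hF
    rintro _ ⟨n, rfl⟩
    exact ⟨n + 1, Function.iterate_succ_apply' F n x⟩

lemma residueLimit_zero_nonempty {f : ℝ → ℝ} {l r x : ℝ} (hx : ∀ n, f^[n] x ∈ Set.Icc l r) :
    (residueLimit f x 1 0).Nonempty := by
  obtain ⟨w, -, hw⟩ := (isCompact_Icc (a := l) (b := r)).exists_mapClusterPt_of_frequently
    (l := atTop) (f := fun n => f^[1 * n + 0] x) (Frequently.of_forall fun n => hx _)
  exact ⟨w, hw⟩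

lemma mapsTo_residueLimit_zero {f : ℝ → ℝ} (hc : Continuous f) (x : ℝ) :
    Set.MapsTo f (residueLimit f x 1 0) (residueLimit f x 1 0) := fun _ hz =>
  residueLimit_subset_of_modEq f x 1 1 (iterate_mem_residueLimit hc hz 1)

lemma iterate_mem_residueLimit_mod {f : ℝ → ℝ} (hc : Continuous f) {x z : ℝ} {N i : ℕ}
    (hz : z ∈ residueLimit f x N i) (m : ℕ) : f^[m] z ∈ residueLimit f x N ((i + m) % N) :=
  residueLimit_subset_of_modEq f x N _ (iterate_mem_residueLimit hc hz m)

lemma injOn_add_mod (N m : ℕ) : Set.InjOn (fun n => (m + n) % N) (Finset.range N) := by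
  intro i hi j hj h
  have hi' := Finset.mem_range.1 (Finset.mem_coe.1 hi)
  have hj' := Finset.mem_range.1 (Finset.mem_coe.1 hj)
  have : i ≡ j [MOD N] := Nat.ModEq.add_left_cancel' m h
  rwa [Nat.ModEq, Nat.mod_eq_of_lt hi', Nat.mod_eq_of_lt hj'] at this

lemma NonTurbulent.sum_diam_residueLimit_mod_le {f : ℝ → ℝ} {l r x : ℝ} (hf : NonTurbulent f)
    (hc : Continuous f) (hx : ∀ n, f^[n] x ∈ Set.Icc l r) (k m : ℕ) :
    ∑ n ∈ Finset.range (2 ^ k), Metric.diam (residueLimit f x (2 ^ k) ((m + n) % 2 ^ k)) ≤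
      r - l :=
  hf.sum_diam_residueLimit_le hc hx k (fun n => (m + n) % 2 ^ k) (by
    simpa only [Nat.mod_mod] using injOn_add_mod (2 ^ k) m)

lemma NonTurbulent.exists_mean_attracted {f : ℝ → ℝ} {l r x : ℝ} (hf : NonTurbulent f)
    (hc : Continuous f) (hx : ∀ n, f^[n] x ∈ Set.Icc l r) {K : Set ℝ}
    (hKx : K ⊆ residueLimit f x 1 0) (hne : K.Nonempty) (hK : Set.MapsTo f K K) {ε : ℝ}
    (hε : 0 < ε) :
    ∃ z ∈ K, limsup (fun N : ℕ => (∑ n ∈ Finset.Icc 1 N, |f^[n] x - f^[n] z|) / N) atTop < ε := by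
  obtain ⟨k, hk⟩ := pow_unbounded_of_one_lt ((r - l) / (ε / 2)) one_lt_two
  have hN : 0 < 2 ^ k := by positivity
  have hNR : (0 : ℝ) < ((2 ^ k : ℕ) : ℝ) := by exact_mod_cast hN
  have hkN : (r - l) / ((2 ^ k : ℕ) : ℝ) < ε / 2 := by
    rw [div_lt_iff₀ (by positivity)] at hk
    rw [div_lt_iff₀ hNR]
    push_cast
    linarith
  set N := 2 ^ k with hNdef
  obtain ⟨z₀, hz₀⟩ := hne
  obtain ⟨i, hi, hzi⟩ := exists_mem_residueLimit (hKx hz₀) hN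
  have hzK : f^[N - i] z₀ ∈ K := hK.iterate _ hz₀
  have hz : f^[N - i] z₀ ∈ residueLimit f x N 0 := by
    have := iterate_mem_residueLimit_mod hc hzi (N - i)
    rwa [Nat.add_sub_cancel' hi.le, Nat.mod_self] at this
  refine ⟨_, hzK, ?_⟩
  set z := f^[N - i] z₀
  have hzI : ∀ n, f^[n] z ∈ Set.Icc l r := fun n =>
    residueLimit_subset_Icc hx _ _ (iterate_mem_residueLimit hc hz n)
  obtain ⟨n₀, hn₀⟩ := eventually_atTop.1
    (eventually_near_residueLimit hx hN (half_pos hε))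
  have := limsup_mean_le_of_block_sum_le (u := fun n => |f^[n] x - f^[n] z|)
    (d := fun n => Metric.diam (residueLimit f x N (n % N))) (C := r - l) (D := r - l)
    (η := ε / 2) (n₀ := n₀) hN (fun _ => abs_nonneg _)
    (fun n => abs_sub_le_iff.2
      ⟨by linarith [(hx n).2, (hzI n).1], by linarith [(hx n).1, (hzI n).2]⟩)
    (fun _ => Metric.diam_nonneg) (half_pos hε).le
    (fun m => hf.sum_diam_residueLimit_mod_le hc hx k (N * m)) (by
      intro n hn
      obtain ⟨w, hw, hxw⟩ := hn₀ n hn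
      have hzn := iterate_mem_residueLimit_mod hc hz n
      rw [zero_add] at hzn
      have hd := Metric.dist_le_diam_of_mem (isBounded_residueLimit hx _ _) hw hzn
      rw [Real.dist_eq] at hd
      have := abs_sub_le (f^[n] x) w (f^[n] z)
      linarith)
  linarith

/-- For finitely many compact sets there is a common `δ` such that any two of them with points
closer than `δ` intersect. -/
lemma exists_pos_forall_inter_nonempty {ι : Type*} (s : Finset ι) {M : ι → Set ℝ}
    (hM : ∀ i ∈ s, IsCompact (M i)) :
    ∃ δ > (0 : ℝ), ∀ i ∈ s, ∀ j ∈ s, ∀ u ∈ M i, ∀ v ∈ M j, |u - v| < δ →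
      (M i ∩ M j).Nonempty := by
  have h : ∀ i ∈ s, ∀ j ∈ s, ∀ᶠ δ in nhdsWithin (0 : ℝ) (Set.Ioi 0),
      ∀ u ∈ M i, ∀ v ∈ M j, |u - v| < δ → (M i ∩ M j).Nonempty := by
    intro i hi j hj
    by_cases hd : (M i ∩ M j).Nonempty
    · exact Eventually.of_forall fun _ _ _ _ _ _ => hd
    · rw [Set.not_nonempty_iff_eq_empty, ← Set.disjoint_iff_inter_eq_empty] at hd
      obtain ⟨δ, hδ, hdt⟩ := hd.exists_thickenings (hM i hi) (hM j hj).isClosed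
      filter_upwards [Ioo_mem_nhdsGT hδ] with t ht u hu v hv huv
      refine absurd (Metric.self_subset_thickening hδ _ hv) (Set.disjoint_left.1 hdt ?_)
      refine Metric.mem_thickening_iff.2 ⟨u, hu, ?_⟩
      rw [dist_comm, Real.dist_eq]
      exact huv.trans ht.2
  have h' := (eventually_all_finset s).2 fun i hi => (eventually_all_finset s).2 (h i hi)
  obtain ⟨δ, hδ, hδ'⟩ := (h'.and self_mem_nhdsWithin).exists
  exact ⟨δ, hδ', hδ⟩

lemma NonTurbulent.exists_mean_stable {f : ℝ → ℝ} {l r x : ℝ} (hf : NonTurbulent f)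
    (hc : Continuous f) (hx : ∀ n, f^[n] x ∈ Set.Icc l r) {K : Set ℝ}
    (hKx : K ⊆ residueLimit f x 1 0) {ε : ℝ} (hε : 0 < ε) :
    ∃ δ > (0 : ℝ), ∀ u ∈ K, ∀ v ∈ K, |u - v| < δ →
      ∃ E : Set ℕ, upperDensity E < ε ∧ ∀ n ∉ E, |f^[n] u - f^[n] v| < ε := by
  obtain ⟨k, hk⟩ := pow_unbounded_of_one_lt (2 * (r - l) / ε / ε) one_lt_two
  have hN : 0 < 2 ^ k := by positivity
  have hNR : (0 : ℝ) < ((2 ^ k : ℕ) : ℝ) := by exact_mod_cast hN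
  have hkN : 2 * (r - l) / ε / ((2 ^ k : ℕ) : ℝ) < ε := by
    rw [div_lt_iff₀ hε] at hk
    rw [div_lt_iff₀ hNR]
    push_cast
    linarith
  set N := 2 ^ k with hNdef
  obtain ⟨δ, hδ, hδM⟩ := exists_pos_forall_inter_nonempty (Finset.range N)
    (M := residueLimit f x N) fun i _ => isCompact_residueLimit hx N i
  refine ⟨δ, hδ, fun u hu v hv huv => ?_⟩
  obtain ⟨i, hi, hui⟩ := exists_mem_residueLimit (hKx hu) hN
  obtain ⟨j, hj, hvj⟩ := exists_mem_residueLimit (hKx hv) hN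
  obtain ⟨c, hci, hcj⟩ :=
    hδM i (Finset.mem_range.2 hi) j (Finset.mem_range.2 hj) u hui v hvj huv
  let D : ℕ → ℕ → ℝ := fun i n => Metric.diam (residueLimit f x N ((i + n) % N))
  have hdist : ∀ n, |f^[n] u - f^[n] v| ≤ D i n + D j n := fun n => by
    have h₁ := Metric.dist_le_diam_of_mem (isBounded_residueLimit hx _ _)
      (iterate_mem_residueLimit_mod hc hui n) (iterate_mem_residueLimit_mod hc hci n)
    have h₂ := Metric.dist_le_diam_of_mem (isBounded_residueLimit hx _ _)
      (iterate_mem_residueLimit_mod hc hcj n) (iterate_mem_residueLimit_mod hc hvj n)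
    rw [Real.dist_eq] at h₁ h₂
    exact (abs_sub_le _ (f^[n] c) _).trans (add_le_add h₁ h₂)
  refine ⟨{n | ε ≤ |f^[n] u - f^[n] v|}, ?_, fun n hn => not_le.1 hn⟩
  have hD : ∀ i m, ∑ n ∈ Finset.range N, D i (N * m + n) ≤ r - l := fun i m => by
    simpa only [D, add_assoc] using hf.sum_diam_residueLimit_mod_le hc hx k (i + N * m)
  have hD0 : ∀ i n, 0 ≤ D i n := fun _ _ => Metric.diam_nonneg
  unfold upperDensity
  refine (limsup_mean_le_of_block_sum_le (d := fun n => (D i n + D j n) / ε) (C := 1)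
    (D := 2 * (r - l) / ε) (η := 0) (n₀ := 0) hN ?_ ?_ ?_ le_rfl ?_ ?_).trans_lt (by linarith)
  · intro n
    split_ifs <;> norm_num
  · intro n
    split_ifs <;> norm_num
  · exact fun n => div_nonneg (add_nonneg (hD0 _ _) (hD0 _ _)) hε.le
  · intro m
    rw [← Finset.sum_div, Finset.sum_add_distrib]
    gcongr
    linarith [hD i m, hD j m]
  · intro n _
    rw [add_zero]
    split_ifs with h
    · rw [le_div_iff₀ hε, one_mul]
      exact le_trans h (hdist n)
    · exact div_nonneg (add_nonneg (hD0 _ _) (hD0 _ _)) hε.le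

/-- A minimal set lies in the limit set of each of its orbits. -/
lemma IsMinimalSet.subset_residueLimit {a b : ℝ} {f : ℝ → ℝ} {K : Set ℝ}
    (hK : IsMinimalSet a b f K) {x : ℝ} (hx : x ∈ K) : K ⊆ residueLimit f x 1 0 := by
  obtain ⟨-, -, -, hm, hd⟩ := hK
  intro y hy
  refine mapClusterPt_iff_frequently.2 fun s hs => frequently_atTop.2 fun m => ?_
  obtain ⟨_, hys, n, rfl⟩ := mem_closure_iff_nhds.1 (hd _ (hm.iterate m hx) hy) s hs
  refine ⟨n + m, Nat.le_add_left _ _, ?_⟩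
  rwa [one_mul, add_zero, Function.iterate_add_apply]

lemma IsMinimalSet.congr {a b : ℝ} {f g : ℝ → ℝ} {K : Set ℝ} (hK : IsMinimalSet a b f K)
    (hfg : ∀ n, ∀ y ∈ Set.Icc a b, f^[n] y = g^[n] y) : IsMinimalSet a b g K := by
  obtain ⟨hI, hne, hc, hm, hd⟩ := hK
  refine ⟨hI, hne, hc, fun y hy => ?_, fun y hy => ?_⟩
  · have := hfg 1 y (hI hy)
    simp only [Function.iterate_one] at this
    exact this ▸ hm hy
  · have := hd y hy
    simpa only [hfg _ y (hI hy)] using this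

/-- Main theorem: the flow generated by a continuous interval map with zero topological
entropy is minimally mean-attractable (every point is mean-attracted to some minimal
set) and minimally mean-L-stable (the restriction to every minimal set is MLS). -/
theorem zero_entropy_MMA_MMLS (a b : ℝ) (f : ℝ → ℝ)
    (hf : ContinuousOn f (Set.Icc a b))
    (hmaps : Set.MapsTo f (Set.Icc a b) (Set.Icc a b))
    (hent : coverEntropy f (Set.Icc a b) = 0) :
    (∀ x ∈ Set.Icc a b, ∃ K : Set ℝ, IsMinimalSet a b f K ∧
      ∀ ε > (0 : ℝ), ∃ z ∈ K,
        limsup (fun N : ℕ => (∑ n ∈ Finset.Icc 1 N, |f^[n] x - f^[n] z|) / N) atTop < ε) ∧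
    (∀ K : Set ℝ, IsMinimalSet a b f K →
      ∀ ε > (0 : ℝ), ∃ δ > (0 : ℝ), ∀ u ∈ K, ∀ v ∈ K, |u - v| < δ →
        ∃ E : Set ℕ, upperDensity E < ε ∧ ∀ n ∉ E, |f^[n] u - f^[n] v| < ε) := by
  rcases lt_or_ge b a with hba | hab
  · constructor
    · intro x hx
      exact absurd (hx.1.trans hx.2) hba.not_ge
    · rintro K ⟨hI, ⟨x, hx⟩, -⟩
      exact absurd ((hI hx).1.trans (hI hx).2) hba.not_ge
  obtain ⟨F, hFc, hFI, hFf⟩ : ∃ F : ℝ → ℝ, Continuous F ∧ (∀ t, F t ∈ Set.Icc a b) ∧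
      Set.EqOn f F (Set.Icc a b) :=
    ⟨Set.IccExtend hab ((Set.Icc a b).domRestrict f), hf.domRestrict.Icc_extend',
      fun t => hmaps (Set.projIcc a b hab t).2,
      fun t ht => (Set.IccExtend_of_mem hab ((Set.Icc a b).domRestrict f) ht).symm⟩
  have hiter : ∀ n, ∀ y ∈ Set.Icc a b, f^[n] y = F^[n] y := by
    intro n
    induction n with
    | zero => exact fun _ _ => rfl
    | succ n ih =>
      intro y hy
      rw [Function.iterate_succ_apply, Function.iterate_succ_apply, ih _ (hmaps hy), hFf hy]
  have hNT := nonTurbulent_of_coverEntropy_eq_zero hFc hFI hiter hent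
  have horb : ∀ x ∈ Set.Icc a b, ∀ n, F^[n] x ∈ Set.Icc a b := fun x hx n =>
    hiter n x hx ▸ hmaps.iterate n hx
  constructor
  · intro x hx
    obtain ⟨K, hKS, hne, hKc, hKm, hKd⟩ := exists_minimal_invariant_subset hFc
      (isCompact_residueLimit (horb x hx) 1 0) (residueLimit_zero_nonempty (horb x hx))
      (mapsTo_residueLimit_zero hFc x)
    have hKI : K ⊆ Set.Icc a b := hKS.trans (residueLimit_subset_Icc (horb x hx) 1 0)
    have hKmin : IsMinimalSet a b F K := ⟨hKI, hne, hKc, hKm, hKd⟩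
    refine ⟨K, hKmin.congr fun n y hy => (hiter n y hy).symm, fun ε hε => ?_⟩
    obtain ⟨z, hz, hlim⟩ := hNT.exists_mean_attracted hFc (horb x hx) hKS hne hKm hε
    exact ⟨z, hz, by simpa only [hiter _ x hx, hiter _ z (hKI hz)] using hlim⟩
  · intro K hK ε hε
    have hKF := hK.congr hiter
    obtain ⟨x, hx⟩ := hK.2.1
    obtain ⟨δ, hδ, h⟩ := hNT.exists_mean_stable hFc (horb x (hK.1 hx))
      (hKF.subset_residueLimit hx) hε
    refine ⟨δ, hδ, fun u hu v hv huv => ?_⟩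
    simpa only [hiter _ u (hK.1 hu), hiter _ v (hK.1 hv)] using h u hu v hv huv
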